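/- Suppose m ≥ 2. Then sup_{λ ∈ (0,∞)^m} R(λ^O, λ) = m − 1/2. -/

import Mathlib

open scoped BigOperators ENNReal

/-- The Poisson(μ) probability of the value `k`. -/
noncomputable def poissonPmf (mu : ℝ) (k : ℕ) : ℝ :=
  mu ^ k * Real.exp (-mu) / (Nat.factorial k)

/-- Joint pmf of (X, Y): X_1, …, X_m, Y independent, X_i ~ Po(λ_i), Y ~ Po(Σ λ_i). -/
noncomputable def jointPmf (m : ℕ) (lam : Fin m → ℝ) (x : Fin m → ℕ) (y : ℕ) : ℝ :=
  poissonPmf (∑ i, lam i) y * ∏ i, poissonPmf (lam i) (x i)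

/-- Risk of an estimator δ under the standardized squared error loss, valued in [0,∞]. -/
noncomputable def risk (m : ℕ) (δ : (Fin m → ℕ) → ℕ → Fin m → ℝ) (lam : Fin m → ℝ) : ℝ≥0∞ :=
  ∑' x : Fin m → ℕ, ∑' y : ℕ,
    ENNReal.ofReal ((∑ i, (δ x y i - lam i) ^ 2 / lam i) * jointPmf m lam x y)

/-- The maximum likelihood estimator λ^ML (real division by zero is 0, giving 0/0 = 0). -/
noncomputable def estML (m : ℕ) (x : Fin m → ℕ) (y : ℕ) (i : Fin m) : ℝ :=
  ((∑ j, (x j : ℝ)) + (y : ℝ)) / 2 * ((x i : ℝ) / ∑ j, (x j : ℝ))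

/-- The shrinkage estimator λ^O. -/
noncomputable def estO (m : ℕ) (x : Fin m → ℕ) (y : ℕ) (i : Fin m) : ℝ :=
  ((∑ j, (x j : ℝ)) + (y : ℝ) + (m : ℝ) - 1) / 2 *
    ((x i : ℝ) / ((∑ j, (x j : ℝ)) + (m : ℝ) - 1))

/-- The second shrinkage estimator λ̂. -/
noncomputable def estHat (m : ℕ) (x : Fin m → ℕ) (y : ℕ) (i : Fin m) : ℝ :=
  ((∑ j, (x j : ℝ)) + (y : ℝ)) / 2 * ((x i : ℝ) / ((∑ j, (x j : ℝ)) + (m : ℝ) - 1))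

/-- The Clevenson–Zidek estimator λ̂X based on X alone. -/
noncomputable def estCZ (m : ℕ) (x : Fin m → ℕ) (y : ℕ) (i : Fin m) : ℝ :=
  (∑ j, (x j : ℝ)) * (x i : ℝ) / ((∑ j, (x j : ℝ)) + (m : ℝ) - 1)

open Filter Topology

/-- The joint pmf of independent Poisson variables with means `lam i`. -/
noncomputable def productPmf {m : ℕ} (lam : Fin m → ℝ) (x : Fin m → ℕ) : ℝ :=
  ∏ i, poissonPmf (lam i) (x i)

lemma poissonPmf_nonneg {mu : ℝ} (h : 0 ≤ mu) (k : ℕ) : 0 ≤ poissonPmf mu k := by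
  unfold poissonPmf; positivity

lemma productPmf_nonneg {m : ℕ} {lam : Fin m → ℝ} (h : ∀ i, 0 ≤ lam i) (x : Fin m → ℕ) :
    0 ≤ productPmf lam x :=
  Finset.prod_nonneg fun i _ => poissonPmf_nonneg (h i) _

lemma hasSum_poissonPmf (mu : ℝ) : HasSum (poissonPmf mu) 1 := by
  convert! (NormedSpace.expSeries_div_hasSum_exp mu).mul_right (Real.exp (-mu)) using 1
  · ext k; unfold poissonPmf; ring
  · rw [← Real.exp_eq_exp_ℝ, ← Real.exp_add]; simp

lemma succ_mul_poissonPmf_succ (mu : ℝ) (k : ℕ) :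
    ((k : ℝ) + 1) * poissonPmf mu (k + 1) = mu * poissonPmf mu k := by
  unfold poissonPmf
  rw [Nat.factorial_succ]
  push_cast
  field_simp
  ring

lemma hasSum_mul_poissonPmf {mu : ℝ} {g : ℝ → ℝ} {a : ℝ}
    (h : HasSum (fun k : ℕ => g (k + 1) * poissonPmf mu k) a) :
    HasSum (fun k : ℕ => (k : ℝ) * g k * poissonPmf mu k) (mu * a) := by
  rw [← hasSum_nat_add_iff' 1]
  convert! h.mul_left mu using 1
  · ext k
    push_cast
    linear_combination g (k + 1) * succ_mul_poissonPmf_succ mu k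
  · simp

lemma hasSum_productPmf {m : ℕ} {lam : Fin m → ℝ} (h : ∀ i, 0 ≤ lam i) :
    HasSum (productPmf lam) 1 := by
  induction m with
  | zero => simpa [productPmf] using hasSum_unique (productPmf lam)
  | succ m ih =>
    have ih := ih (lam := fun i => lam i.succ) fun i => h _
    have h0 := hasSum_poissonPmf (lam 0)
    have hs := h0.summable.mul_of_nonneg ih.summable (poissonPmf_nonneg (h 0))
      (productPmf_nonneg fun i => h _)
    rw [← (Fin.consEquiv fun _ => ℕ).hasSum_iff]
    convert! h0.mul ih hs using 1
    · ext p
      simp [productPmf, Fin.prod_univ_succ, Fin.consEquiv]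
    · simp

lemma productPmf_add_single {m : ℕ} (lam : Fin m → ℝ) (x : Fin m → ℕ) (i : Fin m) :
    ((x i : ℝ) + 1) * productPmf lam (x + Pi.single i 1) = lam i * productPmf lam x := by
  unfold productPmf
  rw [← Finset.mul_prod_erase _ _ (Finset.mem_univ i),
    ← Finset.mul_prod_erase _ (fun j => poissonPmf (lam j) (x j)) (Finset.mem_univ i)]
  have : ∏ j ∈ Finset.univ.erase i, poissonPmf (lam j) ((x + Pi.single i 1 : Fin m → ℕ) j) =
      ∏ j ∈ Finset.univ.erase i, poissonPmf (lam j) (x j) :=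
    Finset.prod_congr rfl fun j hj => by simp [Finset.ne_of_mem_erase hj]
  rw [this]
  simp only [Pi.add_apply, Pi.single_eq_same]
  linear_combination (∏ j ∈ Finset.univ.erase i, poissonPmf (lam j) (x j)) *
    succ_mul_poissonPmf_succ (lam i) (x i)

lemma hasSum_coord_mul_productPmf {m : ℕ} {lam : Fin m → ℝ} (i : Fin m)
    {g : (Fin m → ℕ) → ℝ} {a : ℝ}
    (h : HasSum (fun x => g (x + Pi.single i 1) * productPmf lam x) a) :
    HasSum (fun x => (x i : ℝ) * g x * productPmf lam x) (lam i * a) := by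
  rw [← (add_left_injective (Pi.single i 1 : Fin m → ℕ)).hasSum_iff]
  · convert! h.mul_left (lam i) using 1
    ext x
    simp only [Function.comp_apply, Pi.add_apply, Pi.single_eq_same]
    push_cast
    linear_combination g (x + Pi.single i 1) * productPmf_add_single lam x i
  · intro x hx
    have : x i = 0 := by
      by_contra h0
      refine hx ⟨x - Pi.single i 1, ?_⟩
      ext j
      rcases eq_or_ne j i with rfl | hj
      · simp; omega
      · simp [hj]
    simp [this]

lemma sum_add_single {m : ℕ} (x : Fin m → ℕ) (i : Fin m) :
    ∑ j, (((x + Pi.single i 1 : Fin m → ℕ) j : ℕ) : ℝ) = ∑ j, (x j : ℝ) + 1 := by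
  simp [Finset.sum_add_distrib, Pi.single_apply]

lemma hasSum_total_mul_productPmf {m : ℕ} {lam : Fin m → ℝ} {g : ℝ → ℝ} {a : ℝ}
    (h : HasSum (fun x : Fin m → ℕ => g (∑ j, (x j : ℝ) + 1) * productPmf lam x) a) :
    HasSum (fun x : Fin m → ℕ => (∑ j, (x j : ℝ)) * g (∑ j, (x j : ℝ)) * productPmf lam x)
      ((∑ i, lam i) * a) := by
  rw [Finset.sum_mul]
  simp_rw [Finset.sum_mul]
  refine hasSum_sum fun i _ => hasSum_coord_mul_productPmf i
    (g := fun x => g (∑ j, (x j : ℝ))) ?_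
  simpa only [sum_add_single] using h

lemma hasSum_weighted_sq_mul_productPmf {m : ℕ} {lam : Fin m → ℝ} (hl : ∀ i, 0 < lam i)
    {g : ℝ → ℝ} {a : ℝ}
    (h : HasSum (fun x : Fin m → ℕ =>
      (∑ j, (x j : ℝ) + m) * g (∑ j, (x j : ℝ) + 1) * productPmf lam x) a)
    (hs : ∀ i, Summable fun x : Fin m → ℕ =>
      ((x i : ℝ) + 1) * g (∑ j, (x j : ℝ) + 1) * productPmf lam x) :
    HasSum (fun x : Fin m → ℕ =>
      (∑ i, (x i : ℝ) ^ 2 / lam i) * g (∑ j, (x j : ℝ)) * productPmf lam x) a := by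
  choose b hb using hs
  have hab : a = ∑ i, b i := by
    refine h.unique ?_
    convert! hasSum_sum fun i (_ : i ∈ Finset.univ) => hb i using 1
    ext x
    simp_rw [← Finset.sum_mul, Finset.sum_add_distrib]
    simp
  rw [hab]
  simp_rw [Finset.sum_mul]
  refine hasSum_sum fun i _ => ?_
  have hi : HasSum (fun x : Fin m → ℕ =>
      (x i : ℝ) * ((x i : ℝ) * g (∑ j, (x j : ℝ))) * productPmf lam x) (lam i * b i) := by
    refine hasSum_coord_mul_productPmf i (g := fun x => (x i : ℝ) * g (∑ j, (x j : ℝ))) ?_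
    simp only [sum_add_single]
    simp only [Pi.add_apply, Pi.single_eq_same, Nat.cast_add, Nat.cast_one]
    exact hb i
  convert! hi.div_const (lam i) using 1
  · ext x; ring
  · field_simp [(hl i).ne']

lemma summable_bounded_mul_productPmf {m : ℕ} {lam : Fin m → ℝ} (hl : ∀ i, 0 < lam i)
    {f : (Fin m → ℕ) → ℝ} (C : ℝ) (h : ∀ x, |f x| ≤ C) :
    Summable fun x => f x * productPmf lam x := by
  refine Summable.of_norm_bounded
    ((hasSum_productPmf fun i => (hl i).le).summable.mul_left C) fun x => ?_
  have := productPmf_nonneg (fun i => (hl i).le) x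
  rw [Real.norm_eq_abs, abs_mul, abs_of_nonneg this]
  exact mul_le_mul_of_nonneg_right (h x) this

lemma hasSum_total_productPmf {m : ℕ} {lam : Fin m → ℝ} (hl : ∀ i, 0 < lam i) :
    HasSum (fun x : Fin m → ℕ => (∑ j, (x j : ℝ)) * productPmf lam x) (∑ i, lam i) := by
  have := hasSum_total_mul_productPmf (g := fun _ => 1) (lam := lam) (a := 1)
    (by simpa using hasSum_productPmf fun i => (hl i).le)
  simpa using this

lemma sum_natCast_nonneg {m : ℕ} (x : Fin m → ℕ) : 0 ≤ ∑ j, (x j : ℝ) :=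
  Finset.sum_nonneg fun _ _ => Nat.cast_nonneg _

/-- The mean of `1 / (N + c)` for `N` Poisson with mean `∑ i, lam i`. -/
noncomputable def invMean {m : ℕ} (lam : Fin m → ℝ) (c : ℝ) : ℝ :=
  ∑' x : Fin m → ℕ, 1 / (∑ j, (x j : ℝ) + c) * productPmf lam x

section

variable {m : ℕ} {lam : Fin m → ℝ} {c : ℝ}

lemma hasSum_invMean (hl : ∀ i, 0 < lam i) (hc : 1 ≤ c) :
    HasSum (fun x : Fin m → ℕ => 1 / (∑ j, (x j : ℝ) + c) * productPmf lam x)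
      (invMean lam c) := by
  refine (summable_bounded_mul_productPmf hl 1 fun x => ?_).hasSum
  have := sum_natCast_nonneg x
  rw [abs_of_nonneg (by positivity), div_le_one (by positivity)]
  linarith

lemma sum_mul_invMean_succ (hl : ∀ i, 0 < lam i) (hc : 1 ≤ c) :
    (∑ i, lam i) * invMean lam (c + 1) = 1 - c * invMean lam c := by
  have h1 := hasSum_total_mul_productPmf (g := fun n => 1 / (n + c)) (lam := lam)
    (a := invMean lam (c + 1)) (by
      convert! hasSum_invMean hl (by linarith : 1 ≤ c + 1) using 4
      ring)
  refine h1.unique ?_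
  convert! (hasSum_productPmf fun i => (hl i).le).sub ((hasSum_invMean hl hc).mul_left c) using 1
  ext x
  have := sum_natCast_nonneg x
  field_simp
  ring

lemma sum_mul_invMean_le (hl : ∀ i, 0 < lam i) (hc : 1 ≤ c) :
    (∑ i, lam i) * invMean lam c ≤ 1 := by
  have h1 := hasSum_total_mul_productPmf (g := fun n => 1 / (n + (c - 1))) (lam := lam)
    (a := invMean lam c) (by
      convert! hasSum_invMean hl hc using 4
      ring)
  refine hasSum_le (fun x => ?_) h1 (hasSum_productPmf fun i => (hl i).le)
  refine mul_le_of_le_one_left (productPmf_nonneg (fun i => (hl i).le) x) ?_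
  have := sum_natCast_nonneg x
  rw [mul_one_div]
  exact div_le_one_of_le₀ (by linarith) (by linarith)

lemma le_invMean (hl : ∀ i, 0 < lam i) (hc : 1 ≤ c) :
    1 / (∑ i, lam i + c) ≤ invMean lam c := by
  set L := ∑ i, lam i with hL
  have hL0 : 0 ≤ L := Finset.sum_nonneg fun i _ => (hl i).le
  have hP := hasSum_productPmf fun i => (hl i).le
  have h1 := (hP.mul_left (2 / (L + c) - c / (L + c) ^ 2)).sub
    ((hasSum_total_productPmf hl).mul_left (1 / (L + c) ^ 2))
  refine le_trans (le_of_eq ?_) (hasSum_le (fun x => ?_) h1 (hasSum_invMean hl hc))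
  · rw [← hL]
    field_simp
    ring
  · have hn := sum_natCast_nonneg x
    set n := ∑ j, (x j : ℝ)
    have key : 2 / (L + c) - c / (L + c) ^ 2 - 1 / (L + c) ^ 2 * n ≤ 1 / (n + c) := by
      rw [← sub_nonneg]
      have : 1 / (n + c) - (2 / (L + c) - c / (L + c) ^ 2 - 1 / (L + c) ^ 2 * n) =
          (L - n) ^ 2 / ((n + c) * (L + c) ^ 2) := by
        field_simp
        ring
      rw [this]
      positivity
    calc _ = (2 / (L + c) - c / (L + c) ^ 2 - 1 / (L + c) ^ 2 * n) * productPmf lam x := by ring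
      _ ≤ _ := mul_le_mul_of_nonneg_right key (productPmf_nonneg (fun i => (hl i).le) x)

end

lemma tsum_ofReal_of_hasSum {α : Type*} {f : α → ℝ} {a : ℝ} (h0 : ∀ x, 0 ≤ f x)
    (h : HasSum f a) : ∑' x, ENNReal.ofReal (f x) = ENNReal.ofReal a := by
  rw [← ENNReal.ofReal_tsum_of_nonneg h0 h.summable, h.tsum_eq]

lemma hasSum_quadratic_poissonPmf (mu α β γ : ℝ) :
    HasSum (fun k : ℕ => (α * (k : ℝ) ^ 2 + β * k + γ) * poissonPmf mu k)
      (α * (mu ^ 2 + mu) + β * mu + γ) := by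
  have h0 := hasSum_poissonPmf mu
  have h1 : HasSum (fun k : ℕ => (k : ℝ) * poissonPmf mu k) mu := by
    simpa using hasSum_mul_poissonPmf (g := fun _ => 1) (mu := mu) (a := 1) (by simpa using h0)
  have h2 : HasSum (fun k : ℕ => (k : ℝ) * k * poissonPmf mu k) (mu * (mu + 1)) := by
    refine hasSum_mul_poissonPmf (g := fun t => t) ?_
    convert! h1.add h0 using 1
    ext k; ring
  convert! ((h2.mul_left α).add (h1.mul_left β)).add (h0.mul_left γ) using 1
  · ext k; ring
  · ring

lemma risk_estO {m : ℕ} (hm : 2 ≤ m) {lam : Fin m → ℝ} (hl : ∀ i, 0 < lam i) :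
    risk m (estO m) lam = ENNReal.ofReal (((m : ℝ) + 1) / 4 +
      ((m : ℝ) - 1) * (3 * ∑ i, lam i - 1) / 4 * invMean lam ((m : ℝ) - 1)) := by
  have hm' : (2 : ℝ) ≤ m := by exact_mod_cast hm
  obtain ⟨c, hc⟩ : ∃ c : ℝ, c = (m : ℝ) - 1 := ⟨_, rfl⟩
  have hc1 : 1 ≤ c := by linarith
  have hmc : (m : ℝ) = c + 1 := by linarith
  set L := ∑ i, lam i with hL
  have hL0 : 0 ≤ L := Finset.sum_nonneg fun i _ => (hl i).le
  have hP := hasSum_productPmf fun i => (hl i).le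
  let g : ℝ → ℝ := fun n => 1 / 4 + L / 2 * (1 / (n + c)) +
    (L ^ 2 + L) / 4 * (1 / (n + c)) ^ 2
  have hloss : ∀ (x : Fin m → ℕ) (y : ℕ), ∑ i, (estO m x y i - lam i) ^ 2 / lam i =
      ((∑ j, (x j : ℝ) + y + c) / (2 * (∑ j, (x j : ℝ) + c))) ^ 2 * ∑ i, (x i : ℝ) ^ 2 / lam i -
      (∑ j, (x j : ℝ) + y + c) / (∑ j, (x j : ℝ) + c) * (∑ j, (x j : ℝ)) + L := by
    intro x y
    have hn := sum_natCast_nonneg x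
    rw [hL, Finset.mul_sum, Finset.mul_sum, ← Finset.sum_sub_distrib, ← Finset.sum_add_distrib]
    refine Finset.sum_congr rfl fun i _ => ?_
    have h1 := (hl i).ne'
    unfold estO
    rw [show ∑ j, (x j : ℝ) + (m : ℝ) - 1 = ∑ j, (x j : ℝ) + c by linarith,
      show ∑ j, (x j : ℝ) + (y : ℝ) + (m : ℝ) - 1 = ∑ j, (x j : ℝ) + y + c by linarith]
    generalize ∑ j, (x j : ℝ) = n at *
    have : n + c ≠ 0 := by positivity
    field_simp
    ring
  have hjoint : ∀ (x : Fin m → ℕ) (y : ℕ), 0 ≤ jointPmf m lam x y := fun x y =>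
    mul_nonneg (poissonPmf_nonneg hL0 y) (productPmf_nonneg (fun i => (hl i).le) x)
  have hterm : ∀ (x : Fin m → ℕ) (y : ℕ),
      0 ≤ (∑ i, (estO m x y i - lam i) ^ 2 / lam i) * jointPmf m lam x y := fun x y =>
    mul_nonneg (Finset.sum_nonneg fun i _ => div_nonneg (sq_nonneg _) (hl i).le) (hjoint x y)
  have hinner : ∀ x : Fin m → ℕ, HasSum
      (fun y : ℕ => (∑ i, (estO m x y i - lam i) ^ 2 / lam i) * jointPmf m lam x y)
      (((∑ i, (x i : ℝ) ^ 2 / lam i) * g (∑ j, (x j : ℝ)) - ∑ j, (x j : ℝ)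
        + L * c * (1 / (∑ j, (x j : ℝ) + c))) * productPmf lam x) := by
    intro x
    have hn := sum_natCast_nonneg x
    simp_rw [hloss]
    obtain ⟨n, hn'⟩ : ∃ n, n = ∑ j, (x j : ℝ) := ⟨_, rfl⟩
    obtain ⟨q, hq⟩ : ∃ q, q = ∑ i, (x i : ℝ) ^ 2 / lam i := ⟨_, rfl⟩
    rw [← hn', ← hq]
    rw [← hn'] at hn
    have hnc : n + c ≠ 0 := by positivity
    convert! (hasSum_quadratic_poissonPmf L (q / (4 * (n + c) ^ 2))
      (q / (2 * (n + c)) - n / (n + c)) (q / 4 - n + L)).mul_right (productPmf lam x) using 1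
    · ext y
      unfold jointPmf productPmf
      rw [← hL]
      field_simp
      ring
    · congr 1
      simp only [g]
      field_simp
      ring
  have hB := hasSum_invMean hl hc1
  have hD := hasSum_invMean hl (by linarith : 1 ≤ c + 1)
  have hN := hasSum_total_productPmf hl
  have hq : HasSum (fun x : Fin m → ℕ =>
      (∑ i, (x i : ℝ) ^ 2 / lam i) * g (∑ j, (x j : ℝ)) * productPmf lam x)
      ((L + m) / 4 + L / 2 + (L ^ 2 + L) / 4 * invMean lam (c + 1)) := by
    refine hasSum_weighted_sq_mul_productPmf hl (g := g) ?_ fun i => ?_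
    · convert! ((hN.mul_left (1 / 4)).add (hP.mul_left (m / 4 + L / 2))).add
        (hD.mul_left ((L ^ 2 + L) / 4)) using 1
      · ext x
        have hn := sum_natCast_nonneg x
        generalize ∑ j, (x j : ℝ) = n at *
        simp only [g, hmc]
        have : n + (c + 1) ≠ 0 := by positivity
        have : n + 1 + c ≠ 0 := by positivity
        rw [show n + 1 + c = n + (c + 1) by ring]
        field_simp
        ring
      · rw [← hL]; ring
    · refine Summable.of_nonneg_of_le (fun x => ?_) (fun x => ?_)
        ((hN.summable.add hP.summable).mul_left (1 / 4 + L / 2 + (L ^ 2 + L) / 4))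
      all_goals
        have hn := sum_natCast_nonneg x
        have hp := productPmf_nonneg (fun i => (hl i).le) x
        have hi : (x i : ℝ) ≤ ∑ j, (x j : ℝ) :=
          Finset.single_le_sum (f := fun j => (x j : ℝ)) (fun _ _ => Nat.cast_nonneg _)
            (Finset.mem_univ i)
        generalize ∑ j, (x j : ℝ) = n at *
        have hg0 : 0 ≤ g (n + 1) := by
          simp only [g]
          positivity
      · positivity
      · have ht : 1 / (n + 1 + c) ≤ 1 := by
          rw [div_le_one (by positivity)]; linarith
        have ht0 : 0 ≤ 1 / (n + 1 + c) := by positivity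
        have hg1 : g (n + 1) ≤ 1 / 4 + L / 2 + (L ^ 2 + L) / 4 := by
          simp only [g]
          have := pow_le_one₀ ht0 ht (n := 2)
          have h1 := mul_le_mul_of_nonneg_left ht (by positivity : 0 ≤ L / 2)
          have h2 := mul_le_mul_of_nonneg_left this (by positivity : 0 ≤ (L ^ 2 + L) / 4)
          linarith
        calc ((x i : ℝ) + 1) * g (n + 1) * productPmf lam x
            ≤ (n + 1) * (1 / 4 + L / 2 + (L ^ 2 + L) / 4) * productPmf lam x := by gcongr
          _ = _ := by ring
  have houter := (hq.sub hN).add (hB.mul_left (L * c))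
  unfold risk
  simp_rw [fun x => tsum_ofReal_of_hasSum (hterm x) (hinner x)]
  rw [tsum_ofReal_of_hasSum (fun x => (hinner x).nonneg (hterm x)) (a := _)]
  convert! houter using 1
  · ext x; ring
  · rw [← hL, ← hc, hmc]
    linear_combination (-(L + 1) / 4) * sum_mul_invMean_succ hl hc1

/- STATEMENT 6: for m ≥ 2, sup_{λ ∈ (0,∞)^m} R(λ^O, λ) = m − 1/2 (supremum in [0,∞]). -/
theorem stmt_6 (m : ℕ) (hm : 2 ≤ m) :
    (⨆ lam ∈ {l : Fin m → ℝ | ∀ i, 0 < l i}, risk m (estO m) lam) =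
      ENNReal.ofReal ((m : ℝ) - 1 / 2) := by
  have hm' : (2 : ℝ) ≤ m := by exact_mod_cast hm
  have hc1 : (1 : ℝ) ≤ (m : ℝ) - 1 := by linarith
  apply le_antisymm
  · refine iSup₂_le fun lam hl => ?_
    rw [risk_estO hm hl]
    refine ENNReal.ofReal_le_ofReal ?_
    have h1 := sum_mul_invMean_le hl hc1
    have h2 : 0 ≤ invMean lam ((m : ℝ) - 1) :=
      le_trans (one_div_nonneg.2 (add_nonneg (Finset.sum_nonneg fun i _ => (hl i).le)
        (by linarith))) (le_invMean hl hc1)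
    nlinarith [mul_nonneg (by linarith : (0 : ℝ) ≤ (m : ℝ) - 1) (sub_nonneg.2 h1),
      mul_nonneg (by linarith : (0 : ℝ) ≤ (m : ℝ) - 1) h2]
  · have hlim : Tendsto (fun t : ℝ => ((m : ℝ) + 1) / 4 + ((m : ℝ) - 1) / 4 *
        (3 - (3 * ((m : ℝ) - 1) + 1) / (m * t + ((m : ℝ) - 1)))) atTop
        (𝓝 ((m : ℝ) - 1 / 2)) := by
      have h1 : Tendsto (fun t : ℝ => (m : ℝ) * t + ((m : ℝ) - 1)) atTop atTop :=
        tendsto_atTop_add_const_right _ _ (tendsto_id.const_mul_atTop (by linarith))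
      have h2 := ((((tendsto_const_nhds (x := 3 * ((m : ℝ) - 1) + 1)).div_atTop h1).const_sub
        3).const_mul (((m : ℝ) - 1) / 4)).const_add (((m : ℝ) + 1) / 4)
      convert! h2 using 2
      ring
    refine le_of_tendsto (ENNReal.tendsto_ofReal hlim) ?_
    filter_upwards [eventually_ge_atTop 1] with t ht
    have hl : ∀ i : Fin m, 0 < (fun _ => t : Fin m → ℝ) i := fun _ => by positivity
    refine le_trans ?_ (le_iSup₂ (f := fun lam _ => risk m (estO m) lam) (fun _ => t) hl)
    rw [risk_estO hm hl]
    refine ENNReal.ofReal_le_ofReal ?_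
    have h1 := le_invMean hl hc1
    have hsum : ∑ _i : Fin m, t = m * t := by simp
    simp only [hsum] at h1 ⊢
    have hmt : 1 ≤ (m : ℝ) * t := by nlinarith
    have h2 := mul_le_mul_of_nonneg_left h1
      (by nlinarith : 0 ≤ ((m : ℝ) - 1) * (3 * (m * t) - 1) / 4)
    refine le_trans (le_of_eq ?_) (add_le_add_right h2 _)
    have : (m : ℝ) * t + ((m : ℝ) - 1) ≠ 0 := by linarith
    field_simp
    ring
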